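/- Fix α > 0 and consider the VAE energy L for the dataset x⁽¹⁾ = (1,1), x⁽²⁾ = (−1,−1) as defined in the context. For δ ∈ (0, 1/(α+1)), define the parameter configuration μ⁽¹⁾ = 1, μ⁽²⁾ = −1, W = (α+1, α+1), b = (0,0), σ⁽¹⁾ = σ⁽²⁾ = δ, and γ(δ) = E_{ε~N(0,1)}[2(1 − π_α((α+1)(1 + δε)))²]. Then there exists a constant C (depending on α but not δ) and δ₀ > 0 such that for all δ ∈ (0, δ₀), the energy at this configuration satisfies L ≤ 4 log δ + C; consequently L tends to −∞ as δ → 0⁺, so the infimum of L over all parameters is −∞ and no posterior-collapsed configuration with finite energy is a global minimum. -/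

import Mathlib

open MeasureTheory ProbabilityTheory Real Filter

/-- The soft-threshold operator `π_α(u) = sign(u)·(|u| - α)₊`. -/
noncomputable def softThreshold (α u : ℝ) : ℝ :=
  Real.sign u * max (|u| - α) 0

/-- The two data points of the toy dataset: `x⁽¹⁾ = (1,1)`, `x⁽²⁾ = (-1,-1)`. -/
def dataPt : Fin 2 → Fin 2 → ℝ := ![![1, 1], ![-1, -1]]

/-- The VAE energy for the dataset `x⁽¹⁾ = (1,1)`, `x⁽²⁾ = (-1,-1)` in `ℝ²` with a
one-dimensional latent space:
`L = Σ_{i=1}^{2} { (1/γ)·E_{ε~N(0,1)} ‖x⁽ⁱ⁾ - π_α(W·(μ⁽ⁱ⁾ + σ⁽ⁱ⁾ε)) - b‖₂²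
      + 2 log γ + (σ⁽ⁱ⁾)² - log (σ⁽ⁱ⁾)² + (μ⁽ⁱ⁾)² }`,
where `μ = (μ⁽¹⁾, μ⁽²⁾)` and `σ = (σ⁽¹⁾, σ⁽²⁾)` are the encoder means and
standard deviations of the two data points. -/
noncomputable def vaeEnergy (α : ℝ) (W b : Fin 2 → ℝ) (γ : ℝ)
    (μ σ : Fin 2 → ℝ) : ℝ :=
  ∑ i : Fin 2,
    ((1 / γ) * (∫ ε, (∑ j : Fin 2,
        (dataPt i j - softThreshold α (W j * (μ i + σ i * ε)) - b j) ^ 2)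
          ∂(gaussianReal 0 1))
      + 2 * Real.log γ + (σ i) ^ 2 - Real.log ((σ i) ^ 2) + (μ i) ^ 2)

/-- The decoder variance `γ(δ) = E_{ε~N(0,1)}[2(1 - π_α((α+1)(1 + δε)))²]` of
the parameter configuration used in the proof of Proposition 1. -/
noncomputable def gammaOf (α δ : ℝ) : ℝ :=
  ∫ ε, 2 * (1 - softThreshold α ((α + 1) * (1 + δ * ε))) ^ 2 ∂(gaussianReal 0 1)

theorem softThreshold_eq {α : ℝ} (hα : 0 ≤ α) (u : ℝ) :
    softThreshold α u = max (u - α) 0 - max (-u - α) 0 := by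
  unfold softThreshold
  rcases lt_trichotomy u 0 with h | rfl | h
  · rw [Real.sign_of_neg h, abs_of_neg h, max_eq_right (by linarith : u - α ≤ 0)]
    ring
  · simp
  · rw [Real.sign_of_pos h, abs_of_pos h, max_eq_right (by linarith : -u - α ≤ 0)]
    ring

theorem softThreshold_neg (α u : ℝ) : softThreshold α (-u) = -softThreshold α u := by
  simp [softThreshold, Real.sign_neg]

theorem continuous_softThreshold {α : ℝ} (hα : 0 ≤ α) : Continuous (softThreshold α) := by
  rw [funext (softThreshold_eq hα)]
  fun_prop

theorem abs_softThreshold_sub_le {α : ℝ} (hα : 0 ≤ α) (u v : ℝ) :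
    |softThreshold α u - softThreshold α v| ≤ |u - v| := by
  rw [softThreshold_eq hα, softThreshold_eq hα, abs_le]
  rcases abs_cases (u - v) with ⟨h, _⟩ | ⟨h, _⟩ <;> rw [h] <;> constructor <;>
  rcases max_cases (u - α) 0 with ⟨h₁, _⟩ | ⟨h₁, _⟩ <;>
  rcases max_cases (-u - α) 0 with ⟨h₂, _⟩ | ⟨h₂, _⟩ <;>
  rcases max_cases (v - α) 0 with ⟨h₃, _⟩ | ⟨h₃, _⟩ <;>
  rcases max_cases (-v - α) 0 with ⟨h₄, _⟩ | ⟨h₄, _⟩ <;>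
  linarith

theorem softThreshold_add_one {α : ℝ} (hα : 0 ≤ α) : softThreshold α (α + 1) = 1 := by
  rw [softThreshold_eq hα, max_eq_left (by linarith), max_eq_right (by linarith)]
  ring

/-- The integrand of `gammaOf` is dominated by a multiple of `ε ^ 2`. -/
theorem two_mul_one_sub_softThreshold_sq_le {α : ℝ} (hα : 0 ≤ α) (δ ε : ℝ) :
    2 * (1 - softThreshold α ((α + 1) * (1 + δ * ε))) ^ 2
      ≤ 2 * ((α + 1) * δ) ^ 2 * ε ^ 2 := by
  have h := abs_softThreshold_sub_le hα (α + 1) ((α + 1) * (1 + δ * ε))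
  rw [softThreshold_add_one hα] at h
  nlinarith [sq_le_sq.2 h]

theorem integrable_sq_gaussianReal : Integrable (fun ε : ℝ => ε ^ 2) (gaussianReal 0 1) := by
  simpa using (memLp_id_gaussianReal (μ := 0) (v := 1) 2).integrable_sq

theorem integral_sq_gaussianReal : ∫ ε : ℝ, ε ^ 2 ∂(gaussianReal 0 1) = 1 := by
  have h := variance_id_gaussianReal (μ := 0) (v := 1)
  rw [variance_of_integral_eq_zero aemeasurable_id (by simp)] at h
  simpa using h

theorem continuous_gammaOf_integrand {α : ℝ} (hα : 0 ≤ α) (δ : ℝ) :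
    Continuous fun ε => 2 * (1 - softThreshold α ((α + 1) * (1 + δ * ε))) ^ 2 := by
  have := continuous_softThreshold hα
  fun_prop

theorem integrable_gammaOf_integrand {α : ℝ} (hα : 0 ≤ α) (δ : ℝ) :
    Integrable (fun ε => 2 * (1 - softThreshold α ((α + 1) * (1 + δ * ε))) ^ 2)
      (gaussianReal 0 1) := by
  refine (integrable_sq_gaussianReal.const_mul (2 * ((α + 1) * δ) ^ 2)).mono'
    (continuous_gammaOf_integrand hα δ).aestronglyMeasurable (.of_forall fun ε => ?_)
  rw [Real.norm_of_nonneg (by positivity)]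
  exact two_mul_one_sub_softThreshold_sq_le hα δ ε

theorem gammaOf_le {α : ℝ} (hα : 0 ≤ α) (δ : ℝ) : gammaOf α δ ≤ 2 * ((α + 1) * δ) ^ 2 := by
  calc gammaOf α δ ≤ ∫ ε, 2 * ((α + 1) * δ) ^ 2 * ε ^ 2 ∂(gaussianReal 0 1) :=
        integral_mono (integrable_gammaOf_integrand hα δ)
          (integrable_sq_gaussianReal.const_mul _) (two_mul_one_sub_softThreshold_sq_le hα δ)
    _ = 2 * ((α + 1) * δ) ^ 2 := by
        rw [integral_const_mul, integral_sq_gaussianReal, mul_one]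

theorem gammaOf_pos {α : ℝ} (hα : 0 ≤ α) {δ : ℝ} (hδ : δ ≠ 0) : 0 < gammaOf α δ := by
  have : (gaussianReal 0 1).IsOpenPosMeasure :=
    (gaussianReal_absolutelyContinuous' 0 one_ne_zero).isOpenPosMeasure
  refine integral_pos_of_integrable_nonneg_nonzero (x := -δ⁻¹)
    (continuous_gammaOf_integrand hα δ) (integrable_gammaOf_integrand hα δ)
    (fun ε => by positivity) ?_
  simp [hδ, softThreshold]

/-- The two data points contribute equally, since `ε` and `-ε` have the same law. -/
theorem integral_neg_eq_gammaOf (α δ : ℝ) :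
    ∫ ε, 2 * (-1 - softThreshold α ((α + 1) * (-1 + δ * ε))) ^ 2 ∂(gaussianReal 0 1)
      = gammaOf α δ := by
  have h : (gaussianReal 0 1).map (MeasurableEquiv.neg ℝ) = gaussianReal 0 1 :=
    gaussianReal_map_neg.trans (by rw [neg_zero])
  conv_rhs =>
    rw [gammaOf, ← h, (MeasurableEquiv.neg ℝ).measurableEmbedding.integral_map]
  congr 1 with ε
  change _ = 2 * (1 - softThreshold α ((α + 1) * (1 + δ * -ε))) ^ 2
  rw [show (α + 1) * (-1 + δ * ε) = -((α + 1) * (1 + δ * -ε)) by ring, softThreshold_neg]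
  ring

theorem vaeEnergy_gammaOf {α : ℝ} (hα : 0 ≤ α) {δ : ℝ} (hδ : δ ≠ 0) :
    vaeEnergy α (fun _ => α + 1) (fun _ => 0) (gammaOf α δ) ![1, -1] (fun _ => δ)
      = 4 + 4 * Real.log (gammaOf α δ) + 2 * δ ^ 2 - 4 * Real.log δ := by
  have hγ := (gammaOf_pos hα hδ).ne'
  have h : ∫ ε, 2 * (1 - softThreshold α ((α + 1) * (1 + δ * ε))) ^ 2 ∂(gaussianReal 0 1)
      = gammaOf α δ := rfl
  simp only [vaeEnergy, dataPt, Fin.sum_univ_two, Matrix.cons_val_zero, Matrix.cons_val_one,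
    sub_zero, ← two_mul, integral_neg_eq_gammaOf, h, Real.log_pow]
  field_simp
  push_cast
  ring

theorem vaeEnergy_gammaOf_le {α : ℝ} (hα : 0 ≤ α) {δ : ℝ} (hδ : 0 < δ) (hδ₁ : δ < 1) :
    vaeEnergy α (fun _ => α + 1) (fun _ => 0) (gammaOf α δ) ![1, -1] (fun _ => δ)
      ≤ 4 * Real.log δ + (6 + 4 * Real.log (2 * (α + 1) ^ 2)) := by
  have h := Real.log_le_log (gammaOf_pos hα hδ.ne') (gammaOf_le hα δ)
  rw [mul_pow, ← mul_assoc, Real.log_mul (by positivity) (by positivity),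
    Real.log_pow] at h
  push_cast at h
  rw [vaeEnergy_gammaOf hα hδ.ne']
  nlinarith


/-- Fix `α > 0`.  For `δ ∈ (0, 1/(α+1))` consider the configuration
`μ⁽¹⁾ = 1`, `μ⁽²⁾ = -1`, `W = (α+1, α+1)`, `b = (0,0)`, `σ⁽¹⁾ = σ⁽²⁾ = δ`,
`γ = γ(δ)`.  Then there is a constant `C` (depending on `α` but not `δ`) and
`δ₀ > 0` such that for all `δ ∈ (0, δ₀)` the energy at this configuration is at
most `4 log δ + C`; consequently the energy tends to `-∞` as `δ → 0⁺`, the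
infimum of the energy over all (admissible) parameters is `-∞`, and no
configuration (in particular no posterior-collapsed configuration with finite
energy) is a global minimum. -/
theorem vae_energy_unbounded_below (α : ℝ) (hα : 0 < α) :
    (∃ C : ℝ, ∃ δ₀ : ℝ, 0 < δ₀ ∧ δ₀ ≤ 1 / (α + 1) ∧
      ∀ δ : ℝ, 0 < δ → δ < δ₀ →
        vaeEnergy α (fun _ => α + 1) (fun _ => 0) (gammaOf α δ)
          ![1, -1] (fun _ => δ) ≤ 4 * Real.log δ + C) ∧
    Tendsto (fun δ : ℝ =>
        vaeEnergy α (fun _ => α + 1) (fun _ => 0) (gammaOf α δ)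
          ![1, -1] (fun _ => δ))
      (nhdsWithin 0 (Set.Ioi 0)) atBot ∧
    (∀ M : ℝ, ∃ W b : Fin 2 → ℝ, ∃ γ : ℝ, ∃ μ σ : Fin 2 → ℝ,
      0 < γ ∧ (∀ i, 0 < σ i) ∧ vaeEnergy α W b γ μ σ < M) ∧
    (∀ W b : Fin 2 → ℝ, ∀ γ : ℝ, ∀ μ σ : Fin 2 → ℝ,
      0 < γ → (∀ i, 0 < σ i) →
      ∃ W' b' : Fin 2 → ℝ, ∃ γ' : ℝ, ∃ μ' σ' : Fin 2 → ℝ,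
        0 < γ' ∧ (∀ i, 0 < σ' i) ∧
        vaeEnergy α W' b' γ' μ' σ' < vaeEnergy α W b γ μ σ) := by
  have hδ₀ : 0 < 1 / (α + 1) := by positivity
  have hδ₁ : 1 / (α + 1) ≤ 1 := by rw [div_le_one (by positivity)]; linarith
  have hle (δ : ℝ) (h : 0 < δ) (h' : δ < 1 / (α + 1)) :=
    vaeEnergy_gammaOf_le hα.le h (h'.trans_le hδ₁)
  have hlim : Tendsto (fun δ : ℝ =>
      vaeEnergy α (fun _ => α + 1) (fun _ => 0) (gammaOf α δ) ![1, -1] (fun _ => δ))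
      (nhdsWithin 0 (Set.Ioi 0)) atBot := by
    refine tendsto_atBot_mono' _ ?_ (tendsto_atBot_add_const_right _
      (6 + 4 * Real.log (2 * (α + 1) ^ 2))
      (Real.tendsto_log_nhdsGT_zero.const_mul_atBot (by norm_num : (0 : ℝ) < 4)))
    filter_upwards [Ioo_mem_nhdsGT hδ₀] with δ hδ using hle δ hδ.1 hδ.2
  have hunb (M : ℝ) : ∃ W b : Fin 2 → ℝ, ∃ γ : ℝ, ∃ μ σ : Fin 2 → ℝ,
      0 < γ ∧ (∀ i, 0 < σ i) ∧ vaeEnergy α W b γ μ σ < M := by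
    obtain ⟨δ, hM, hδ⟩ := ((hlim.eventually_lt_atBot M).and self_mem_nhdsWithin).exists
    exact ⟨_, _, _, _, _, gammaOf_pos hα.le (ne_of_gt hδ), fun _ => hδ, hM⟩
  exact ⟨⟨_, _, hδ₀, le_rfl, hle⟩, hlim, hunb, fun W b γ μ σ _ _ => hunb _⟩
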